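/- arXiv:1109.1021 — 11 statements merged into one kernel-verified Lean document; each statement's English description precedes it below -/
import Mathlib

section
/- Let N ≥ 1 be an integer and let P_I, P_f, P_m ∈ (0,1) with P_f + P_m < 1. Then the map k ↦ P_{N,k}^I is strictly decreasing on {0,1,…,N}, and consequently k ↦ P_{N,k}^B is strictly increasing on {0,1,…,N}. -/
/-- Conditional probability that the channel is idle given k of N SUs report busy. -/
noncomputable def PNI (N k : ℕ) (PI Pf Pm : ℝ) : ℝ :=
  (PI * (1 - Pf) ^ (N - k) * Pf ^ k) /
    (PI * (1 - Pf) ^ (N - k) * Pf ^ k + (1 - PI) * Pm ^ (N - k) * (1 - Pm) ^ k)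

/-- Conditional probability that the channel is busy given k of N SUs report busy. -/
noncomputable def PNB (N k : ℕ) (PI Pf Pm : ℝ) : ℝ := 1 - PNI N k PI Pf Pm

theorem PNI_lt_PNI {N k l : ℕ} {PI Pf Pm : ℝ} (hPI0 : 0 < PI) (hPI1 : PI < 1)
    (hPf0 : 0 < Pf) (hPf1 : Pf < 1) (hPm0 : 0 < Pm) (hPm1 : Pm < 1) (hfm : Pf + Pm < 1)
    (hkl : k < l) (hl : l ≤ N) : PNI N l PI Pf Pm < PNI N k PI Pf Pm := by
  obtain ⟨d, rfl⟩ := Nat.exists_eq_add_of_lt hkl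
  obtain ⟨e, rfl⟩ := Nat.exists_eq_add_of_le hl
  have hI : 0 < 1 - PI := sub_pos.2 hPI1
  have hf : 0 < 1 - Pf := sub_pos.2 hPf1
  have hm : 0 < 1 - Pm := sub_pos.2 hPm1
  have hlt : Pf * Pm < (1 - Pf) * (1 - Pm) := by linarith
  have hpow : (Pf * Pm) ^ (d + 1) < ((1 - Pf) * (1 - Pm)) ^ (d + 1) :=
    pow_lt_pow_left₀ hlt (by positivity) d.succ_ne_zero
  have hcommon :
      0 < PI * (1 - PI) * (1 - Pf) ^ e * Pf ^ k * Pm ^ e * (1 - Pm) ^ k := by positivity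
  have hmul := mul_lt_mul_of_pos_left hpow hcommon
  have hsub_l : k + d + 1 + e - (k + d + 1) = e := by omega
  have hsub_k : k + d + 1 + e - k = d + 1 + e := by omega
  unfold PNI
  rw [hsub_l, hsub_k, div_lt_div_iff₀ (by positivity) (by positivity)]
  simp only [mul_pow, pow_add, pow_one] at hmul ⊢
  linarith

theorem PNI_strict_anti_PNB_strict_mono
    (N : ℕ) (hN : 1 ≤ N) (PI Pf Pm : ℝ)
    (hPI0 : 0 < PI) (hPI1 : PI < 1)
    (hPf0 : 0 < Pf) (hPf1 : Pf < 1)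
    (hPm0 : 0 < Pm) (hPm1 : Pm < 1)
    (hfm : Pf + Pm < 1) :
    (∀ k l : ℕ, k < l → l ≤ N → PNI N l PI Pf Pm < PNI N k PI Pf Pm) ∧
    (∀ k l : ℕ, k < l → l ≤ N → PNB N k PI Pf Pm < PNB N l PI Pf Pm) := by
  have hanti : ∀ k l : ℕ, k < l → l ≤ N → PNI N l PI Pf Pm < PNI N k PI Pf Pm :=
    fun _ _ => PNI_lt_PNI hPI0 hPI1 hPf0 hPf1 hPm0 hPm1 hfm
  exact ⟨hanti, fun k l hkl hl => sub_lt_sub_left (hanti k l hkl hl) 1⟩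
end

section
/- Let N ≥ 1 be an integer, let P_I, P_f, P_m ∈ (0,1) with P_f + P_m < 1, and let C_p > (P_I/(1−P_I))·((1−P_f)/P_m)^N·(1/N)·(P_m·P_f)/((1−P_m)(1−P_f)). Then for every integer k with 1 ≤ k ≤ N, P_{N,k}^I·(1/N) − P_{N,k}^B·C_p < 0. -/
/-- A weighted difference of complementary fractions `A / (A + B)` and `B / (A + B)`. -/
theorem div_add_mul_sub_compl_mul_neg {A B x y : ℝ} (hAB : 0 < A + B) (h : A * x < B * y) :
    A / (A + B) * x - (1 - A / (A + B)) * y < 0 := by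
  have heq : A / (A + B) * x - (1 - A / (A + B)) * y = (A * x - B * y) / (A + B) := by
    field_simp
    ring
  rw [heq]
  exact div_neg_of_neg_of_pos (sub_neg.mpr h) hAB

theorem no_transmit_when_some_busy
    (N : ℕ) (hN : 1 ≤ N) (PI Pf Pm Cp : ℝ)
    (hPI0 : 0 < PI) (hPI1 : PI < 1)
    (hPf0 : 0 < Pf) (hPf1 : Pf < 1)
    (hPm0 : 0 < Pm) (hPm1 : Pm < 1)
    (hfm : Pf + Pm < 1)
    (hCp : Cp > (PI / (1 - PI)) * ((1 - Pf) / Pm) ^ N * (1 / N) *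
        (Pm * Pf) / ((1 - Pm) * (1 - Pf))) :
    ∀ k : ℕ, 1 ≤ k → k ≤ N →
      PNI N k PI Pf Pm * (1 / N) - PNB N k PI Pf Pm * Cp < 0 := by
  intro k hk hkN
  have ha : 0 < 1 - Pf := sub_pos.mpr hPf1
  have hb : 0 < 1 - Pm := sub_pos.mpr hPm1
  have hI : 0 < 1 - PI := sub_pos.mpr hPI1
  have hN0 : (0 : ℝ) < N := by exact_mod_cast hN
  unfold PNB PNI
  apply div_add_mul_sub_compl_mul_neg (by positivity)
  set r : ℝ := Pm * Pf / ((1 - Pm) * (1 - Pf)) with hr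
  have hr0 : 0 < r := by positivity
  have hr1 : r ≤ 1 := by
    rw [hr, div_le_one (by positivity)]
    nlinarith
  have hrk : r ^ k ≤ r := pow_le_of_le_one hr0.le hr1 (by omega)
  set B : ℝ := (1 - PI) * Pm ^ (N - k) * (1 - Pm) ^ k with hB
  have hB0 : 0 < B := by positivity
  set c : ℝ := PI / (1 - PI) * ((1 - Pf) / Pm) ^ N * (1 / N) with hc
  have hc0 : 0 < c := by positivity
  have hratio : PI * (1 - Pf) ^ (N - k) * Pf ^ k * (1 / N) = B * (c * r ^ k) := by
    obtain ⟨j, rfl⟩ := Nat.exists_eq_add_of_le hkN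
    rw [hB, hc, hr, Nat.add_sub_cancel_left]
    simp only [div_pow, mul_pow, pow_add]
    field_simp
  rw [mul_div_assoc] at hCp
  calc PI * (1 - Pf) ^ (N - k) * Pf ^ k * (1 / N) = B * (c * r ^ k) := hratio
    _ ≤ B * (c * r) := by gcongr
    _ < B * Cp := by gcongr
end

section
/- Let N ≥ 1 be an integer, let P_I, P_f, P_m ∈ (0,1) with P_f + P_m < 1, and let C_p > 0. Then the following two conditions hold simultaneously: (i) P_{N,0}^I·(1/N) − P_{N,0}^B·C_p > 0, and (ii) P_{N,k}^I·(1/N) − P_{N,k}^B·C_p < 0 for every integer 1 ≤ k ≤ N; if and only if Condition I holds: (P_I/(1−P_I))·((1−P_f)/P_m)^N·(1/N)·(P_m·P_f)/((1−P_m)(1−P_f)) < C_p < (P_I/(1−P_I))·((1−P_f)/P_m)^N·(1/N). (This is the condition under which the OR fusion rule outperforms all other n-out-of-N rules.) -/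
/-- The net reward `PNI * c - PNB * Cp` is the odds of the channel being idle times `c`, minus `Cp`,
up to a positive factor. -/
lemma PNI_mul_sub_PNB_mul (N k : ℕ) {PI Pf Pm : ℝ} (c Cp : ℝ)
    (hPI0 : 0 < PI) (hPI1 : PI < 1) (hPf0 : 0 < Pf) (hPf1 : Pf < 1)
    (hPm0 : 0 < Pm) (hPm1 : Pm < 1) :
    ∃ r > 0, PNI N k PI Pf Pm * c - PNB N k PI Pf Pm * Cp =
      r * (PI / (1 - PI) * (((1 - Pf) / Pm) ^ (N - k) * (Pf / (1 - Pm)) ^ k) * c - Cp) := by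
  have hI : 0 < 1 - PI := sub_pos.2 hPI1
  have hf : 0 < 1 - Pf := sub_pos.2 hPf1
  have hm : 0 < 1 - Pm := sub_pos.2 hPm1
  refine ⟨(1 - PI) * Pm ^ (N - k) * (1 - Pm) ^ k /
    (PI * (1 - Pf) ^ (N - k) * Pf ^ k + (1 - PI) * Pm ^ (N - k) * (1 - Pm) ^ k),
    by positivity, ?_⟩
  have hD : PI * (1 - Pf) ^ (N - k) * Pf ^ k + (1 - PI) * Pm ^ (N - k) * (1 - Pm) ^ k ≠ 0 := by
    positivity
  simp only [PNB, PNI, div_pow]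
  field_simp
  ring

/-- For `b ≤ 1 ≤ a`, the product `a ^ (N - k) * b ^ k` over `k ≥ 1` is largest at `k = 1`. -/
lemma pow_sub_mul_pow_le {a b : ℝ} (ha : 1 ≤ a) (hb0 : 0 ≤ b) (hb1 : b ≤ 1) (N : ℕ) {k : ℕ}
    (hk : 1 ≤ k) : a ^ (N - k) * b ^ k ≤ a ^ (N - 1) * b ^ 1 :=
  mul_le_mul (pow_le_pow_right₀ ha (by lia)) (pow_le_pow_of_le_one hb0 hb1 hk)
    (by positivity) (by positivity)

theorem or_rule_optimal_iff_conditionI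
    (N : ℕ) (hN : 1 ≤ N) (PI Pf Pm Cp : ℝ)
    (hPI0 : 0 < PI) (hPI1 : PI < 1)
    (hPf0 : 0 < Pf) (hPf1 : Pf < 1)
    (hPm0 : 0 < Pm) (hPm1 : Pm < 1)
    (hfm : Pf + Pm < 1) (hCp : 0 < Cp) :
    (PNI N 0 PI Pf Pm * (1 / N) - PNB N 0 PI Pf Pm * Cp > 0 ∧
      ∀ k : ℕ, 1 ≤ k → k ≤ N →
        PNI N k PI Pf Pm * (1 / N) - PNB N k PI Pf Pm * Cp < 0) ↔
    ((PI / (1 - PI)) * ((1 - Pf) / Pm) ^ N * (1 / N) *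
        (Pm * Pf) / ((1 - Pm) * (1 - Pf)) < Cp ∧
      Cp < (PI / (1 - PI)) * ((1 - Pf) / Pm) ^ N * (1 / N)) := by
  have hI : 0 < 1 - PI := sub_pos.2 hPI1
  have hf : 0 < 1 - Pf := sub_pos.2 hPf1
  have hm : 0 < 1 - Pm := sub_pos.2 hPm1
  have hneg (k : ℕ) : PNI N k PI Pf Pm * (1 / N) - PNB N k PI Pf Pm * Cp < 0 ↔
      PI / (1 - PI) * (((1 - Pf) / Pm) ^ (N - k) * (Pf / (1 - Pm)) ^ k) * (1 / N) < Cp := by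
    obtain ⟨r, hr, h⟩ := PNI_mul_sub_PNB_mul N k (1 / N) Cp hPI0 hPI1 hPf0 hPf1 hPm0 hPm1
    rw [h, ← neg_pos, ← mul_neg, mul_pos_iff_of_pos_left hr, neg_pos, sub_neg]
  have hpos : PNI N 0 PI Pf Pm * (1 / N) - PNB N 0 PI Pf Pm * Cp > 0 ↔
      Cp < PI / (1 - PI) * ((1 - Pf) / Pm) ^ N * (1 / N) := by
    obtain ⟨r, hr, h⟩ := PNI_mul_sub_PNB_mul N 0 (1 / N) Cp hPI0 hPI1 hPf0 hPf1 hPm0 hPm1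
    rw [h, gt_iff_lt, mul_pos_iff_of_pos_left hr, sub_pos, Nat.sub_zero, pow_zero, mul_one]
  have hone : PI / (1 - PI) * ((1 - Pf) / Pm) ^ N * (1 / N) * (Pm * Pf) / ((1 - Pm) * (1 - Pf)) =
      PI / (1 - PI) * (((1 - Pf) / Pm) ^ (N - 1) * (Pf / (1 - Pm)) ^ 1) * (1 / N) := by
    obtain ⟨n, rfl⟩ := Nat.exists_eq_add_of_le' hN
    rw [Nat.add_sub_cancel, pow_succ]
    field_simp
  have ha : 1 ≤ (1 - Pf) / Pm := (one_le_div hPm0).2 (by linarith)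
  have hb : Pf / (1 - Pm) ≤ 1 := (div_le_one hm).2 (by linarith)
  simp only [hneg]
  rw [hpos, hone, and_comm]
  refine and_congr_left fun _ => ⟨fun h => h 1 le_rfl hN, fun h k hk _ => lt_of_le_of_lt ?_ h⟩
  have := pow_sub_mul_pow_le ha (by positivity) hb N hk
  gcongr
end

section
/- Let N ≥ 2 and 1 ≤ M < N be integers, let P_I, P_f, P_m ∈ (0,1), and let C_p > 0 satisfy C_p < (P_I/(1−P_I))·((1−P_f)/P_m)^N·(1/N) (the upper bound of Condition I). Then the attackers' reward from falsely reporting busy and transmitting exclusively strictly exceeds their reward from honestly sharing the channel, which is in turn positive: P_{N,0}^I − M·P_{N,0}^B·C_p > M·(P_{N,0}^I·(1/N) − P_{N,0}^B·C_p) > 0. (Hence when all N sensors sense the channel idle, the M cooperating attackers optimally report busy and transmit exclusively.) -/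
theorem PNI_zero_pos {N : ℕ} {PI Pf Pm : ℝ} (hPI0 : 0 < PI) (hPI1 : PI < 1)
    (hPf1 : Pf < 1) (hPm0 : 0 < Pm) : 0 < PNI N 0 PI Pf Pm := by
  have hPI : 0 < 1 - PI := sub_pos.2 hPI1
  have hPf : 0 < 1 - Pf := sub_pos.2 hPf1
  unfold PNI
  positivity

theorem PNB_zero_pos_and_PNI_zero_eq {N : ℕ} {PI Pf Pm : ℝ} (hPI0 : 0 < PI) (hPI1 : PI < 1)
    (hPf1 : Pf < 1) (hPm0 : 0 < Pm) :
    0 < PNB N 0 PI Pf Pm ∧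
      PNI N 0 PI Pf Pm = PNB N 0 PI Pf Pm * (PI / (1 - PI) * ((1 - Pf) / Pm) ^ N) := by
  have hPI : 0 < 1 - PI := sub_pos.2 hPI1
  have hPf : 0 < 1 - Pf := sub_pos.2 hPf1
  have hden : 0 < PI * (1 - Pf) ^ N + (1 - PI) * Pm ^ N := by positivity
  have hPNB : PNB N 0 PI Pf Pm =
      (1 - PI) * Pm ^ N / (PI * (1 - Pf) ^ N + (1 - PI) * Pm ^ N) := by
    simp only [PNB, PNI, Nat.sub_zero, pow_zero, mul_one]
    rw [eq_div_iff hden.ne', sub_mul, div_mul_cancel₀ _ hden.ne']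
    ring
  rw [hPNB]
  refine ⟨by positivity, ?_⟩
  simp only [PNI, Nat.sub_zero, pow_zero, mul_one, div_pow]
  field_simp

theorem attack_dominates_honest_all_idle
    (N M : ℕ) (hN : 2 ≤ N) (hM1 : 1 ≤ M) (hMN : M < N)
    (PI Pf Pm Cp : ℝ)
    (hPI0 : 0 < PI) (hPI1 : PI < 1)
    (hPf0 : 0 < Pf) (hPf1 : Pf < 1)
    (hPm0 : 0 < Pm) (hPm1 : Pm < 1)
    (hCp0 : 0 < Cp)
    (hCp : Cp < (PI / (1 - PI)) * ((1 - Pf) / Pm) ^ N * (1 / N)) :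
    PNI N 0 PI Pf Pm - M * PNB N 0 PI Pf Pm * Cp >
      M * (PNI N 0 PI Pf Pm * (1 / N) - PNB N 0 PI Pf Pm * Cp) ∧
    M * (PNI N 0 PI Pf Pm * (1 / N) - PNB N 0 PI Pf Pm * Cp) > 0 := by
  have hI := PNI_zero_pos (N := N) hPI0 hPI1 hPf1 hPm0
  obtain ⟨hB, hIB⟩ := PNB_zero_pos_and_PNI_zero_eq (N := N) hPI0 hPI1 hPf1 hPm0
  have hN0 : (0 : ℝ) < N := by positivity
  have hM0 : (0 : ℝ) < M := by exact_mod_cast hM1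
  have hshare : (M : ℝ) / N < 1 := (div_lt_one hN0).2 (by exact_mod_cast hMN)
  constructor
  · have hlt := mul_lt_mul_of_pos_left hshare hI
    have hrw : M * (PNI N 0 PI Pf Pm * (1 / N) - PNB N 0 PI Pf Pm * Cp) =
        PNI N 0 PI Pf Pm * (M / N) - M * PNB N 0 PI Pf Pm * Cp := by ring
    linarith
  · refine mul_pos hM0 (sub_pos.2 ?_)
    rw [hIB, mul_assoc]
    exact mul_lt_mul_of_pos_left hCp hB
end

section
/- Let N ≥ 2 and 1 ≤ M < N be integers, let P_I, P_f, P_m ∈ (0,1) with P_f + P_m < 1, and let C_p satisfy the lower bound of Condition I: C_p > (P_I/(1−P_I))·((1−P_f)/P_m)^N·(1/N)·(P_m·P_f)/((1−P_m)(1−P_f)). Then for every integer M̄ with 1 ≤ M̄ ≤ M, the attackers' reward from truthfully reporting (so that all N users transmit) is strictly negative: M·(P_{N,M̄}^I·(1/N) − P_{N,M̄}^B·C_p) < 0; hence it is strictly smaller than max(0, P_{N,M̄}^I − M·P_{N,M̄}^B·C_p), the best reward the attackers can obtain by letting the fusion center announce busy. -/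
/-- The posterior odds of idle against busy shrink by a factor
`Pm * Pf / ((1 - Pm) * (1 - Pf))` with each busy report. -/
theorem idle_weight_eq_odds_mul_busy_weight {N k : ℕ} (hk : k ≤ N) {PI Pf Pm : ℝ}
    (hPI : PI < 1) (hPf : Pf < 1) (hPm0 : 0 < Pm) (hPm1 : Pm < 1) :
    PI * (1 - Pf) ^ (N - k) * Pf ^ k =
      (PI / (1 - PI) * ((1 - Pf) / Pm) ^ N * (Pm * Pf / ((1 - Pm) * (1 - Pf))) ^ k) *
        ((1 - PI) * Pm ^ (N - k) * (1 - Pm) ^ k) := by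
  obtain ⟨j, rfl⟩ := Nat.exists_eq_add_of_le hk
  have h1 : 1 - PI ≠ 0 := by linarith
  have h2 : 1 - Pf ≠ 0 := by linarith
  have h3 : 1 - Pm ≠ 0 := by linarith
  have h4 : Pm ≠ 0 := hPm0.ne'
  rw [Nat.add_sub_cancel_left]
  simp only [div_pow, mul_pow, pow_add]
  field_simp

theorem truthful_report_reward_negative_when_attacker_senses_busy
    (N M : ℕ) (hN : 2 ≤ N) (hM1 : 1 ≤ M) (hMN : M < N)
    (PI Pf Pm Cp : ℝ)
    (hPI0 : 0 < PI) (hPI1 : PI < 1)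
    (hPf0 : 0 < Pf) (hPf1 : Pf < 1)
    (hPm0 : 0 < Pm) (hPm1 : Pm < 1)
    (hfm : Pf + Pm < 1)
    (hCp : Cp > (PI / (1 - PI)) * ((1 - Pf) / Pm) ^ N * (1 / N) *
        (Pm * Pf) / ((1 - Pm) * (1 - Pf))) :
    ∀ Mbar : ℕ, 1 ≤ Mbar → Mbar ≤ M →
      M * (PNI N Mbar PI Pf Pm * (1 / N) - PNB N Mbar PI Pf Pm * Cp) < 0 ∧
      M * (PNI N Mbar PI Pf Pm * (1 / N) - PNB N Mbar PI Pf Pm * Cp) <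
        max 0 (PNI N Mbar PI Pf Pm - M * PNB N Mbar PI Pf Pm * Cp) := by
  intro k hk hkM
  have hkN : k ≤ N := (hkM.trans_lt hMN).le
  have hN0 : (0 : ℝ) < N := by exact_mod_cast (by omega : 0 < N)
  have hM0 : (0 : ℝ) < M := by exact_mod_cast hM1
  have h1 : 0 < 1 - PI := by linarith
  have h2 : 0 < 1 - Pf := by linarith
  have h3 : 0 < 1 - Pm := by linarith
  have hodds := idle_weight_eq_odds_mul_busy_weight (PI := PI) hkN hPI1 hPf1 hPm0 hPm1
  set r := Pm * Pf / ((1 - Pm) * (1 - Pf)) with hr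
  have hr0 : 0 < r := by positivity
  have hr1 : r ≤ 1 := by
    rw [hr, div_le_one (by positivity)]
    nlinarith
  have hrk : r ^ k ≤ r := pow_le_of_le_one hr0.le hr1 (by omega)
  have hA : 0 < PI * (1 - Pf) ^ (N - k) * Pf ^ k := by positivity
  have hB : 0 < (1 - PI) * Pm ^ (N - k) * (1 - Pm) ^ k := by positivity
  have hneg : M * (PNI N k PI Pf Pm * (1 / N) - PNB N k PI Pf Pm * Cp) < 0 := by
    refine mul_neg_of_pos_of_neg hM0 ?_
    unfold PNB PNI
    set A := PI * (1 - Pf) ^ (N - k) * Pf ^ k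
    set B := (1 - PI) * Pm ^ (N - k) * (1 - Pm) ^ k
    set c := PI / (1 - PI) * ((1 - Pf) / Pm) ^ N with hc
    have hc0 : 0 < c := by positivity
    have hCp' : c * r * (1 / N) < Cp := by
      calc c * r * (1 / N) = c * (1 / N) * (Pm * Pf) / ((1 - Pm) * (1 - Pf)) := by
            rw [hr]; ring
        _ < Cp := hCp
    have key : A * (1 / N) < B * Cp := by
      calc A * (1 / N) = B * (c * r ^ k * (1 / N)) := by rw [hodds]; ring
        _ ≤ B * (c * r * (1 / N)) := by gcongr
        _ < B * Cp := by gcongr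
    have hAB : A + B ≠ 0 := (add_pos hA hB).ne'
    have hrew : A / (A + B) * (1 / N) - (1 - A / (A + B)) * Cp =
        (A * (1 / N) - B * Cp) / (A + B) := by
      field_simp
      ring
    rw [hrew]
    exact div_neg_of_neg_of_pos (sub_neg.mpr key) (add_pos hA hB)
  exact ⟨hneg, hneg.trans_le (le_max_left _ _)⟩
end

section
/- Let N ≥ 2 and 1 ≤ M < N be integers, let P_I, P_f, P_m ∈ (0,1) with P_f + P_m < 1, let C_p > 0, and define the direct-punishment threshold C_b^{th}(M) = max( (P_I/(1−P_I))·((1−P_f)/P_m)^N·(P_f·P_m/((1−P_f)(1−P_m)))·(1/M) − C_p , (P_I/(1−P_I))·((1−P_f)/P_m)^N·(1/M − 1/N) ). Then for every C_b > C_b^{th}(M): (i) M·(P_{N,0}^I·(1/N) − P_{N,0}^B·C_p) > P_{N,0}^I − M·P_{N,0}^B·(C_p + C_b), i.e., honest behavior strictly dominates attacking when all sensors report idle; and (ii) for every integer 1 ≤ k ≤ N, P_{N,k}^I − M·P_{N,k}^B·(C_p + C_b) < 0, i.e., transmitting after a busy announcement yields negative expected reward. Hence a direct punishment C_b > C_b^{th}(M)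 prevents all attacks. -/
/-- The busy posterior is positive. -/
theorem PNB_pos (N k : ℕ) {PI Pf Pm : ℝ} (hPI0 : 0 < PI) (hPI1 : PI < 1)
    (hPf0 : 0 < Pf) (hPf1 : Pf < 1) (hPm0 : 0 < Pm) (hPm1 : Pm < 1) :
    0 < PNB N k PI Pf Pm := by
  have hI : 0 < 1 - PI := sub_pos.2 hPI1
  have hf : 0 < 1 - Pf := sub_pos.2 hPf1
  have hm : 0 < 1 - Pm := sub_pos.2 hPm1
  have hA : 0 < PI * (1 - Pf) ^ (N - k) * Pf ^ k := by positivity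
  have hB : 0 < (1 - PI) * Pm ^ (N - k) * (1 - Pm) ^ k := by positivity
  rw [PNB, PNI, sub_pos, div_lt_one (add_pos hA hB)]
  exact lt_add_of_pos_right _ hB

/-- The posterior odds of idle against busy: each busy report multiplies them by
`Pf * Pm / ((1 - Pf) * (1 - Pm))`. -/
theorem PNI_eq_odds_mul_PNB {N k : ℕ} (hk : k ≤ N) {PI Pf Pm : ℝ} (hPI0 : 0 < PI) (hPI1 : PI < 1)
    (hPf0 : 0 < Pf) (hPf1 : Pf < 1) (hPm0 : 0 < Pm) (hPm1 : Pm < 1) :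
    PNI N k PI Pf Pm = (PI / (1 - PI)) * ((1 - Pf) / Pm) ^ N *
      ((Pf * Pm) / ((1 - Pf) * (1 - Pm))) ^ k * PNB N k PI Pf Pm := by
  have hI : 0 < 1 - PI := sub_pos.2 hPI1
  have hf : 0 < 1 - Pf := sub_pos.2 hPf1
  have hm : 0 < 1 - Pm := sub_pos.2 hPm1
  have hA : 0 < PI * (1 - Pf) ^ (N - k) * Pf ^ k := by positivity
  have hB : 0 < (1 - PI) * Pm ^ (N - k) * (1 - Pm) ^ k := by positivity
  have hodds : PI * (1 - Pf) ^ (N - k) * Pf ^ k =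
      (PI / (1 - PI)) * ((1 - Pf) / Pm) ^ N * ((Pf * Pm) / ((1 - Pf) * (1 - Pm))) ^ k *
        ((1 - PI) * Pm ^ (N - k) * (1 - Pm) ^ k) := by
    obtain ⟨j, rfl⟩ := Nat.exists_eq_add_of_le hk
    simp only [Nat.add_sub_cancel_left, div_pow, mul_pow, pow_add]
    field_simp
  rw [PNB, PNI, one_sub_div (add_pos hA hB).ne', add_sub_cancel_left, ← mul_div_assoc, ← hodds]

theorem direct_punishment_prevents_all_attacks
    (N M : ℕ) (hN : 2 ≤ N) (hM1 : 1 ≤ M) (hMN : M < N)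
    (PI Pf Pm Cp Cb : ℝ)
    (hPI0 : 0 < PI) (hPI1 : PI < 1)
    (hPf0 : 0 < Pf) (hPf1 : Pf < 1)
    (hPm0 : 0 < Pm) (hPm1 : Pm < 1)
    (hfm : Pf + Pm < 1) (hCp : 0 < Cp)
    (hCb : Cb > max
      ((PI / (1 - PI)) * ((1 - Pf) / Pm) ^ N *
        ((Pf * Pm) / ((1 - Pf) * (1 - Pm))) * (1 / M) - Cp)
      ((PI / (1 - PI)) * ((1 - Pf) / Pm) ^ N * (1 / M - 1 / N))) :
    (M * (PNI N 0 PI Pf Pm * (1 / N) - PNB N 0 PI Pf Pm * Cp) >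
      PNI N 0 PI Pf Pm - M * PNB N 0 PI Pf Pm * (Cp + Cb)) ∧
    (∀ k : ℕ, 1 ≤ k → k ≤ N →
      PNI N k PI Pf Pm - M * PNB N k PI Pf Pm * (Cp + Cb) < 0) := by
  have hI : 0 < 1 - PI := sub_pos.2 hPI1
  have hf : 0 < 1 - Pf := sub_pos.2 hPf1
  have hm : 0 < 1 - Pm := sub_pos.2 hPm1
  have hM : (0 : ℝ) < M := Nat.cast_pos.2 hM1
  obtain ⟨hbusy, hidle⟩ := max_lt_iff.1 hCb
  have hR : 0 < (PI / (1 - PI)) * ((1 - Pf) / Pm) ^ N := by positivity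
  have hodds := fun {k : ℕ} (hk : k ≤ N) =>
    PNI_eq_odds_mul_PNB hk hPI0 hPI1 hPf0 hPf1 hPm0 hPm1
  have hpos := fun k : ℕ => PNB_pos N k hPI0 hPI1 hPf0 hPf1 hPm0 hPm1
  have hq0 : 0 ≤ (Pf * Pm) / ((1 - Pf) * (1 - Pm)) := by positivity
  have hq1 : (Pf * Pm) / ((1 - Pf) * (1 - Pm)) ≤ 1 := by
    rw [div_le_one (by positivity)]
    linarith
  generalize (PI / (1 - PI)) * ((1 - Pf) / Pm) ^ N = R at *
  generalize (Pf * Pm) / ((1 - Pf) * (1 - Pm)) = q at *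
  refine ⟨?_, fun k hk1 hkN => ?_⟩
  · rw [hodds (Nat.zero_le N), pow_zero, mul_one, gt_iff_lt, ← sub_pos]
    have h := mul_pos (mul_pos hM (hpos 0)) (sub_pos.2 hidle)
    have hMM : (M : ℝ) * (1 / M) = 1 := mul_one_div_cancel hM.ne'
    linear_combination h - R * PNB N 0 PI Pf Pm * hMM
  · have hqk : q ^ k ≤ q := pow_le_of_le_one hq0 hq1 (Nat.one_le_iff_ne_zero.1 hk1)
    have hlt : R * q < M * (Cp + Cb) := by
      have h : R * q * (1 / M) < Cp + Cb := by linarith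
      rwa [mul_one_div, div_lt_iff₀' hM] at h
    have hle : R * q ^ k ≤ R * q := mul_le_mul_of_nonneg_left hqk hR.le
    rw [hodds hkN]
    have h := mul_neg_of_neg_of_pos (sub_neg.2 (hle.trans_lt hlt)) (hpos k)
    linear_combination h
end

section
/- Let P_I, P_f, P_m ∈ (0,1) with P_f + P_m < 1 and C_p > 0, and for integers N ≥ 2 and 1 ≤ M ≤ N define C_b^{th}(M, N) = max( (P_I/(1−P_I))·((1−P_f)/P_m)^N·(P_f·P_m/((1−P_f)(1−P_m)))·(1/M) − C_p , (P_I/(1−P_I))·((1−P_f)/P_m)^N·(1/M − 1/N) ). Then: (i) for fixed N, C_b^{th}(M, N) is strictly decreasing in M on {1, …, N}; (ii) for fixed M, C_b^{th}(M, N) is strictly increasing in N on {M+1, M+2, …}; and (iii) for fixed N, max over 1 ≤ M ≤ N of C_b^{th}(M, N) equals C_b^{th}(1, N). -/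
/-- Direct-punishment threshold for M attackers among N secondary users. -/
noncomputable def Cbth (PI Pf Pm Cp : ℝ) (M N : ℕ) : ℝ :=
  max
    ((PI / (1 - PI)) * ((1 - Pf) / Pm) ^ N *
      ((Pf * Pm) / ((1 - Pf) * (1 - Pm))) * (1 / M) - Cp)
    ((PI / (1 - PI)) * ((1 - Pf) / Pm) ^ N * (1 / M - 1 / N))

theorem Cbth_strictAnti_attackers {PI Pf Pm : ℝ} (Cp : ℝ) (hPI0 : 0 < PI) (hPI1 : PI < 1)
    (hPf0 : 0 < Pf) (hPf1 : Pf < 1) (hPm0 : 0 < Pm) (hPm1 : Pm < 1)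
    (N : ℕ) {M₁ M₂ : ℕ} (hM₁ : 1 ≤ M₁) (hM : M₁ < M₂) :
    Cbth PI Pf Pm Cp M₂ N < Cbth PI Pf Pm Cp M₁ N := by
  have hPI : 0 < 1 - PI := sub_pos.2 hPI1
  have hPf : 0 < 1 - Pf := sub_pos.2 hPf1
  have hPm : 0 < 1 - Pm := sub_pos.2 hPm1
  have hM₁' : (0 : ℝ) < M₁ := by exact_mod_cast hM₁
  have hinv : 1 / (M₂ : ℝ) < 1 / M₁ :=
    one_div_lt_one_div_of_lt hM₁' (by exact_mod_cast hM)
  unfold Cbth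
  apply max_lt_max
  · exact sub_lt_sub_right (mul_lt_mul_of_pos_left hinv (by positivity)) _
  · exact mul_lt_mul_of_pos_left (sub_lt_sub_right hinv _) (by positivity)

theorem Cbth_strictMono_users {PI Pf Pm : ℝ} (Cp : ℝ) (hPI0 : 0 < PI) (hPI1 : PI < 1)
    (hPf0 : 0 < Pf) (hPf1 : Pf < 1) (hPm0 : 0 < Pm) (hPm1 : Pm < 1) (hfm : Pf + Pm < 1)
    {M N₁ N₂ : ℕ} (hM : 1 ≤ M) (hMN : M < N₁) (hN : N₁ < N₂) :
    Cbth PI Pf Pm Cp M N₁ < Cbth PI Pf Pm Cp M N₂ := by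
  have hPI : 0 < 1 - PI := sub_pos.2 hPI1
  have hPf : 0 < 1 - Pf := sub_pos.2 hPf1
  have hPm : 0 < 1 - Pm := sub_pos.2 hPm1
  have hM' : (0 : ℝ) < M := by exact_mod_cast hM
  have hMN' : (M : ℝ) < N₁ := by exact_mod_cast hMN
  have hinvM : 1 / (N₁ : ℝ) < 1 / M := one_div_lt_one_div_of_lt hM' hMN'
  have hinvN : 1 / (N₂ : ℝ) < 1 / N₁ :=
    one_div_lt_one_div_of_lt (hM'.trans hMN') (by exact_mod_cast hN)
  have hratio : 1 < (1 - Pf) / Pm := (one_lt_div hPm0).2 (by linarith)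
  have hpow : PI / (1 - PI) * ((1 - Pf) / Pm) ^ N₁ < PI / (1 - PI) * ((1 - Pf) / Pm) ^ N₂ :=
    mul_lt_mul_of_pos_left (pow_lt_pow_right₀ hratio hN) (by positivity)
  unfold Cbth
  apply max_lt_max
  · refine sub_lt_sub_right (mul_lt_mul_of_pos_right ?_ (by positivity)) _
    exact mul_lt_mul_of_pos_right hpow (by positivity)
  · exact mul_lt_mul hpow (by linarith) (sub_pos.2 hinvM) (by positivity)

theorem Cbth_monotonicity
    (PI Pf Pm Cp : ℝ)
    (hPI0 : 0 < PI) (hPI1 : PI < 1)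
    (hPf0 : 0 < Pf) (hPf1 : Pf < 1)
    (hPm0 : 0 < Pm) (hPm1 : Pm < 1)
    (hfm : Pf + Pm < 1) (hCp : 0 < Cp) :
    (∀ N : ℕ, 2 ≤ N → ∀ M₁ M₂ : ℕ, 1 ≤ M₁ → M₁ < M₂ → M₂ ≤ N →
      Cbth PI Pf Pm Cp M₂ N < Cbth PI Pf Pm Cp M₁ N) ∧
    (∀ M : ℕ, 1 ≤ M → ∀ N₁ N₂ : ℕ, M < N₁ → N₁ < N₂ → 2 ≤ N₁ →
      Cbth PI Pf Pm Cp M N₁ < Cbth PI Pf Pm Cp M N₂) ∧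
    (∀ N : ℕ, 2 ≤ N → ∀ M : ℕ, 1 ≤ M → M ≤ N →
      Cbth PI Pf Pm Cp M N ≤ Cbth PI Pf Pm Cp 1 N) := by
  refine ⟨fun N _ M₁ M₂ hM₁ hM _ => ?_, fun M hM N₁ N₂ hMN hN _ => ?_, fun N _ M hM _ => ?_⟩
  · exact Cbth_strictAnti_attackers Cp hPI0 hPI1 hPf0 hPf1 hPm0 hPm1 N hM₁ hM
  · exact Cbth_strictMono_users Cp hPI0 hPI1 hPf0 hPf1 hPm0 hPm1 hfm hM hMN hN
  · rcases hM.eq_or_lt with rfl | hM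
    · exact le_rfl
    · exact (Cbth_strictAnti_attackers Cp hPI0 hPI1 hPf0 hPf1 hPm0 hPm1 N le_rfl hM).le
end

section
/- Let N ≥ 2 and 1 ≤ M < N be integers, P_I, P_f, P_m ∈ (0,1), C_p > 0, and suppose the per-slot honest reward a := P_I(1−P_f)^N·(1/N) − (1−P_I)P_m^N·C_p is positive. Define LR^H = (M/(1−δ))·a and LR_{WC}^{DH} = ( P_I(1−P_f)^N − M(1−P_I)P_m^N·C_p ) / ( 1 − δ·(1 − (1−P_I)P_m^N) ), and define δ^{th}_{WC}(M) = ( 1 + (a / (1/M − 1/N))·((1−P_I)/P_I)·(P_m/(1−P_f))^N )^{−1}. Then for every δ with δ^{th}_{WC}(M) < δ < 1, we have LR_{WC}^{DH} < LR^H; i.e., in the weak-cooperation case, the indirect punishment makes honest behavior strictly better for the attackers whenever the discount factor exceeds δ^{th}_{WC}(M). -/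
/-- In terms of the gain `A` of a successful transmission, the per-slot detection probability `q`, the
honest reward `a` and the rate gap `d = 1 / M - 1 / N`, a discount factor above the threshold makes
the attack, worth `m * d * A + m * a` per slot, less profitable than honest behavior. -/
theorem attack_reward_lt_honest_reward {A q a d m δ : ℝ} (hA : 0 < A) (hq : 0 < q) (ha : 0 < a)
    (hd : 0 < d) (hm : 0 < m) (hδ1 : δ < 1) (hδ : (1 + a / d * (q / A))⁻¹ < δ) :
    (m * d * A + m * a) / (1 - δ * (1 - q)) < m / (1 - δ) * a := by
  have hδ0 : 0 < δ := lt_trans (by positivity) hδ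
  have hthreshold : d * A < δ * (d * A + a * q) := by
    have h : (1 + a / d * (q / A))⁻¹ = d * A / (d * A + a * q) := by
      field_simp
    rwa [h, div_lt_iff₀ (by positivity)] at hδ
  have hden : 0 < 1 - δ * (1 - q) := by nlinarith
  rw [div_mul_eq_mul_div, div_lt_div_iff₀ hden (by linarith)]
  linear_combination m * hthreshold

theorem indirect_punishment_weak_cooperation
    (N M : ℕ) (hN : 2 ≤ N) (hM1 : 1 ≤ M) (hMN : M < N)
    (PI Pf Pm Cp δ : ℝ)
    (hPI0 : 0 < PI) (hPI1 : PI < 1)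
    (hPf0 : 0 < Pf) (hPf1 : Pf < 1)
    (hPm0 : 0 < Pm) (hPm1 : Pm < 1)
    (hCp : 0 < Cp)
    (ha : 0 < PI * (1 - Pf) ^ N * (1 / N) - (1 - PI) * Pm ^ N * Cp)
    (hδ1 : δ < 1)
    (hδth : (1 + (PI * (1 - Pf) ^ N * (1 / N) - (1 - PI) * Pm ^ N * Cp) /
        ((1 : ℝ) / M - 1 / N) * ((1 - PI) / PI) * (Pm / (1 - Pf)) ^ N)⁻¹ < δ) :
    (PI * (1 - Pf) ^ N - M * (1 - PI) * Pm ^ N * Cp) /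
        (1 - δ * (1 - (1 - PI) * Pm ^ N)) <
      (M / (1 - δ)) * (PI * (1 - Pf) ^ N * (1 / N) - (1 - PI) * Pm ^ N * Cp) := by
  have hN0 : (0 : ℝ) < N := by exact_mod_cast (by omega : 0 < N)
  have hM0 : (0 : ℝ) < M := by exact_mod_cast hM1
  have hd : (0 : ℝ) < 1 / M - 1 / N :=
    sub_pos.2 (one_div_lt_one_div_of_lt hM0 (by exact_mod_cast hMN))
  have hPI : 0 < 1 - PI := sub_pos.2 hPI1
  have hPf : 0 < 1 - Pf := sub_pos.2 hPf1
  rw [mul_assoc, div_pow, div_mul_div_comm] at hδth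
  have key := attack_reward_lt_honest_reward (by positivity) (by positivity) ha hd hM0 hδ1 hδth
  convert key using 2
  field_simp
  ring
end

section
/- Let N ≥ 2 and 1 ≤ M < N be integers and P_I, P_f, P_m ∈ (0,1). Viewing the thresholds as functions of C_p: (i) δ^{th}_{WC}(M) = ( 1 + ((P_I(1−P_f)^N·(1/N) − (1−P_I)P_m^N·C_p) / (1/M − 1/N))·((1−P_I)/P_I)·(P_m/(1−P_f))^N )^{−1} is strictly increasing in C_p on the interval where P_I(1−P_f)^N·(1/N) − (1−P_I)P_m^N·C_p > 0; and (ii) δ^{th}_{SC}(M) = ( 1 + (( (P_I(1−P_f)^N·(1/N) − (1−P_I)P_m^N·C_p) − (P_I(1−P_f)^M·(1/M) − (1−P_I)P_m^M·C_p) ) / (1/M − 1/N))·((1−P_I)/P_I)·(P_m/(1−P_f))^N )^{−1} is strictly decreasing in C_p on the interval where its bracketed numerator is positive. -/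
/-- Weak-cooperation discount-factor threshold, as a function of `Cp`. -/
noncomputable def deltaWC (PI Pf Pm : ℝ) (N M : ℕ) (Cp : ℝ) : ℝ :=
  (1 + (PI * (1 - Pf) ^ N * (1 / N) - (1 - PI) * Pm ^ N * Cp) /
      ((1 : ℝ) / M - 1 / N) * ((1 - PI) / PI) * (Pm / (1 - Pf)) ^ N)⁻¹

/-- Strong-cooperation discount-factor threshold, as a function of `Cp`. -/
noncomputable def deltaSC (PI Pf Pm : ℝ) (N M : ℕ) (Cp : ℝ) : ℝ :=
  (1 + ((PI * (1 - Pf) ^ N * (1 / N) - (1 - PI) * Pm ^ N * Cp) -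
        (PI * (1 - Pf) ^ M * (1 / M) - (1 - PI) * Pm ^ M * Cp)) /
      ((1 : ℝ) / M - 1 / N) * ((1 - PI) / PI) * (Pm / (1 - Pf)) ^ N)⁻¹

theorem strictAntiOn_inv_one_add_div_mul {d a b : ℝ} (hd : 0 < d) (ha : 0 < a) (hb : 0 < b) :
    StrictAntiOn (fun x : ℝ => (1 + x / d * a * b)⁻¹) (Set.Ioi 0) := by
  intro x hx y _ hxy
  have hx' : 0 < x := hx
  have h : x / d * a * b < y / d * a * b := by gcongr
  exact inv_strictAnti₀ (by positivity) (by linarith)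

theorem delta_thresholds_monotone_in_Cp
    (N M : ℕ) (hN : 2 ≤ N) (hM1 : 1 ≤ M) (hMN : M < N)
    (PI Pf Pm : ℝ)
    (hPI0 : 0 < PI) (hPI1 : PI < 1)
    (hPf0 : 0 < Pf) (hPf1 : Pf < 1)
    (hPm0 : 0 < Pm) (hPm1 : Pm < 1) :
    StrictMonoOn (deltaWC PI Pf Pm N M)
      {Cp : ℝ | 0 < PI * (1 - Pf) ^ N * (1 / N) - (1 - PI) * Pm ^ N * Cp} ∧
    StrictAntiOn (deltaSC PI Pf Pm N M)
      {Cp : ℝ | 0 < (PI * (1 - Pf) ^ N * (1 / N) - (1 - PI) * Pm ^ N * Cp) -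
        (PI * (1 - Pf) ^ M * (1 / M) - (1 - PI) * Pm ^ M * Cp)} := by
  have hM0 : (0 : ℝ) < M := by exact_mod_cast hM1
  have hd : (0 : ℝ) < 1 / M - 1 / N :=
    sub_pos.mpr (one_div_lt_one_div_of_lt hM0 (by exact_mod_cast hMN))
  have hq : 0 < 1 - PI := sub_pos.mpr hPI1
  have hf : 0 < 1 - Pf := sub_pos.mpr hPf1
  have key := strictAntiOn_inv_one_add_div_mul hd (div_pos hq hPI0) (pow_pos (div_pos hPm0 hf) N)
  refine ⟨fun x hx y hy hxy => key hy hx ?_, fun x hx y hy hxy => key hx hy ?_⟩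
  · have := mul_lt_mul_of_pos_left hxy (mul_pos hq (pow_pos hPm0 N))
    linarith
  · have hpow : Pm ^ N < Pm ^ M := pow_lt_pow_right_of_lt_one₀ hPm0 hPm1 hMN
    have := mul_pos (mul_pos hq (sub_pos.mpr hpow)) (sub_pos.mpr hxy)
    linarith
end

section
/- Let N ≥ 2 be an integer, P_I, P_f, P_m, P_{f,A}, P_{m,A} ∈ (0,1), r_A > 0, C_p ∈ ℝ, C_b ∈ ℝ. Define Q^I = P_I(1−P_f)^{N−1}(1−P_{f,A}) / ( P_I(1−P_f)^{N−1}(1−P_{f,A}) + (1−P_I)P_m^{N−1}P_{m,A} ) and Q^B = 1 − Q^I. Then Q^I·(r_A/N) − Q^B·C_p > Q^I·r_A − Q^B·(C_p + C_b) if and only if C_b > (P_I(1−P_{f,A})/((1−P_I)P_{m,A}))·((1−P_f)/P_m)^{N−1}·((N−1)/N)·r_A. -/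
/-- With idle weight `a` and busy weight `b`, sharing the channel among `n` users beats exclusive
transmission exactly when the punishment `p` exceeds the odds-weighted gain `a / b * ((n - 1) / n) * r`. -/
theorem shared_reward_gt_exclusive_reward_iff {a b n : ℝ} (ha : 0 < a) (hb : 0 < b) (hn : n ≠ 0)
    (r c p : ℝ) :
    a / (a + b) * (r / n) - (1 - a / (a + b)) * c >
        a / (a + b) * r - (1 - a / (a + b)) * (c + p) ↔
      p > a / b * ((n - 1) / n) * r := by
  have hab : 0 < a + b := add_pos ha hb
  have key : a / (a + b) * (r / n) - (1 - a / (a + b)) * c -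
      (a / (a + b) * r - (1 - a / (a + b)) * (c + p)) =
      b / (a + b) * (p - a / b * ((n - 1) / n) * r) := by
    field_simp
    ring
  rw [gt_iff_lt, ← sub_pos, key, mul_pos_iff_of_pos_left (div_pos hb hab), sub_pos]

theorem heterogeneous_single_attacker_deterrence_iff
    (N : ℕ) (hN : 2 ≤ N)
    (PI Pf Pm PfA PmA rA Cp Cb : ℝ)
    (hPI0 : 0 < PI) (hPI1 : PI < 1)
    (hPf0 : 0 < Pf) (hPf1 : Pf < 1)
    (hPm0 : 0 < Pm) (hPm1 : Pm < 1)
    (hPfA0 : 0 < PfA) (hPfA1 : PfA < 1)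
    (hPmA0 : 0 < PmA) (hPmA1 : PmA < 1)
    (hrA : 0 < rA) :
    (PI * (1 - Pf) ^ (N - 1) * (1 - PfA) /
        (PI * (1 - Pf) ^ (N - 1) * (1 - PfA) + (1 - PI) * Pm ^ (N - 1) * PmA) *
        (rA / N) -
      (1 - PI * (1 - Pf) ^ (N - 1) * (1 - PfA) /
        (PI * (1 - Pf) ^ (N - 1) * (1 - PfA) + (1 - PI) * Pm ^ (N - 1) * PmA)) * Cp >
      PI * (1 - Pf) ^ (N - 1) * (1 - PfA) /
        (PI * (1 - Pf) ^ (N - 1) * (1 - PfA) + (1 - PI) * Pm ^ (N - 1) * PmA) * rA -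
      (1 - PI * (1 - Pf) ^ (N - 1) * (1 - PfA) /
        (PI * (1 - Pf) ^ (N - 1) * (1 - PfA) + (1 - PI) * Pm ^ (N - 1) * PmA)) *
        (Cp + Cb)) ↔
      Cb > (PI * (1 - PfA) / ((1 - PI) * PmA)) * ((1 - Pf) / Pm) ^ (N - 1) *
        (((N : ℝ) - 1) / N) * rA := by
  have h1 : 0 < 1 - PI := sub_pos.2 hPI1
  have h2 : 0 < 1 - Pf := sub_pos.2 hPf1
  have h3 : 0 < 1 - PfA := sub_pos.2 hPfA1
  have hN0 : (N : ℝ) ≠ 0 := Nat.cast_ne_zero.2 (by omega)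
  have odds : PI * (1 - PfA) / ((1 - PI) * PmA) * ((1 - Pf) / Pm) ^ (N - 1) =
      PI * (1 - Pf) ^ (N - 1) * (1 - PfA) / ((1 - PI) * Pm ^ (N - 1) * PmA) := by
    rw [div_pow, div_mul_div_comm, mul_right_comm PI, mul_right_comm (1 - PI)]
  rw [odds]
  exact shared_reward_gt_exclusive_reward_iff (by positivity) (by positivity) hN0 rA Cp Cb
end

section
/- Let N ≥ 2 be an integer, P_I ∈ (0,1), r_A > 0, C_p ≥ 0, and P_f, P_m, P_{f,A}, P_{m,A} ∈ (0, 0.1). Define C_b^{th1} = (P_I(1−P_{f,A})/((1−P_I)P_{m,A}))·((1−P_f)/P_m)^{N−1}·((N−1)/N)·r_A, C_b^{th2} = (P_I·P_{f,A}/((1−P_I)(1−P_{m,A})))·((1−P_f)/P_m)^{N−1}·r_A − C_p, and C_b^{th3} = (P_I/(1−P_I))·((1−P_f)/P_m)^{N−1}·(P_f·P_m/((1−P_f)(1−P_m)))·((1−P_{f,A})/P_{m,A})·r_A − C_p. Then C_b^{th1} > C_b^{th2} and C_b^{th1} > C_b^{th3}; consequently max(C_b^{th1}, C_b^{th2}, C_b^{th3})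 = C_b^{th1}. -/
theorem div_one_sub_lt_one_ninth {p q : ℝ} (hp : p < 0.1) (hq : q < 0.1) :
    p / (1 - q) < 1 / 9 := by
  rw [div_lt_div_iff₀ (by linarith) (by norm_num)]
  linarith

theorem one_half_le_sub_one_div {N : ℕ} (hN : 2 ≤ N) : (1 / 2 : ℝ) ≤ ((N : ℝ) - 1) / N := by
  have hN' : (2 : ℝ) ≤ N := by exact_mod_cast hN
  rw [div_le_div_iff₀ (by norm_num) (by linarith)]
  linarith

theorem heterogeneous_threshold_comparison
    (N : ℕ) (hN : 2 ≤ N)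
    (PI Pf Pm PfA PmA rA Cp : ℝ)
    (hPI0 : 0 < PI) (hPI1 : PI < 1)
    (hrA : 0 < rA) (hCp : 0 ≤ Cp)
    (hPf0 : 0 < Pf) (hPf1 : Pf < 0.1)
    (hPm0 : 0 < Pm) (hPm1 : Pm < 0.1)
    (hPfA0 : 0 < PfA) (hPfA1 : PfA < 0.1)
    (hPmA0 : 0 < PmA) (hPmA1 : PmA < 0.1) :
    (PI * (1 - PfA) / ((1 - PI) * PmA)) * ((1 - Pf) / Pm) ^ (N - 1) *
        (((N : ℝ) - 1) / N) * rA >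
      (PI * PfA / ((1 - PI) * (1 - PmA))) * ((1 - Pf) / Pm) ^ (N - 1) * rA - Cp ∧
    (PI * (1 - PfA) / ((1 - PI) * PmA)) * ((1 - Pf) / Pm) ^ (N - 1) *
        (((N : ℝ) - 1) / N) * rA >
      (PI / (1 - PI)) * ((1 - Pf) / Pm) ^ (N - 1) *
        ((Pf * Pm) / ((1 - Pf) * (1 - Pm))) * ((1 - PfA) / PmA) * rA - Cp ∧
    max (max
        ((PI * (1 - PfA) / ((1 - PI) * PmA)) * ((1 - Pf) / Pm) ^ (N - 1) *
          (((N : ℝ) - 1) / N) * rA)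
        ((PI * PfA / ((1 - PI) * (1 - PmA))) * ((1 - Pf) / Pm) ^ (N - 1) * rA - Cp))
      ((PI / (1 - PI)) * ((1 - Pf) / Pm) ^ (N - 1) *
        ((Pf * Pm) / ((1 - Pf) * (1 - Pm))) * ((1 - PfA) / PmA) * rA - Cp) =
      (PI * (1 - PfA) / ((1 - PI) * PmA)) * ((1 - Pf) / Pm) ^ (N - 1) *
        (((N : ℝ) - 1) / N) * rA := by
  have hK : 0 < PI / (1 - PI) * ((1 - Pf) / Pm) ^ (N - 1) * rA := by
    have h₁ : 0 < 1 - PI := by linarith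
    have h₂ : 0 < 1 - Pf := by linarith
    positivity
  have hN' := one_half_le_sub_one_div hN
  have ha : 9 < (1 - PfA) / PmA := by
    rw [lt_div_iff₀ hPmA0]
    linarith
  have hb := div_one_sub_lt_one_ninth hPfA1 hPmA1
  have hc : Pf * Pm / ((1 - Pf) * (1 - Pm)) < 1 / 2 := by
    rw [mul_div_mul_comm]
    have h₁ := div_one_sub_lt_one_ninth hPf1 hPf1
    have h₂ := div_one_sub_lt_one_ninth hPm1 hPm1
    have h₃ : 0 < Pm / (1 - Pm) := div_pos hPm0 (by linarith)
    nlinarith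
  rw [mul_div_mul_comm PI (1 - PfA), mul_div_mul_comm PI PfA]
  generalize PI / (1 - PI) = o at *
  generalize ((1 - Pf) / Pm) ^ (N - 1) = Q at *
  generalize (1 - PfA) / PmA = a at *
  generalize PfA / (1 - PmA) = b at *
  generalize Pf * Pm / ((1 - Pf) * (1 - Pm)) = c at *
  generalize ((N : ℝ) - 1) / N = n at *
  have h₂ : o * b * Q * rA - Cp < o * a * Q * n * rA := by
    have : b < a * n := by nlinarith
    linarith [mul_lt_mul_of_pos_left this hK]
  have h₃ : o * Q * c * a * rA - Cp < o * a * Q * n * rA := by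
    have : c * a < n * a := mul_lt_mul_of_pos_right (by linarith) (by linarith)
    linarith [mul_lt_mul_of_pos_left this hK]
  exact ⟨h₂, h₃, by rw [max_eq_left h₂.le, max_eq_left h₃.le]⟩
end
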